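/- Let m⃗ ∈ Ind(F) be a singular vector for g = A(CK_6) ≅ E(1,6) with T(m⃗) = Σ_{k=0}^{N} Θ^k Σ_{I∈I_<} η_I ⊗ v_{I,k}. Then the degree of m⃗ in Θ is at most 2, and moreover T(m⃗) = Θ² Σ_{|I|≥5} η_I ⊗ v_{I,2} + Θ Σ_{|I|≥3} η_I ⊗ v_{I,1} + Σ_{|I|≥1} η_I ⊗ v_{I,0}. -/

import Mathlib

/-!
STATEMENT 17 (Lemma 4.4 of Boyallian–Kac–Liberati; Lemma `lemck6grado`):
let `m⃗ ∈ Ind(F)` be a singular vector for `g = A(CK₆) ≅ E(1,6)`, with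
`T(m⃗) = Σ_{k=0}^N Θᵏ Σ_{I ∈ I_<} η_I ⊗ v_{I,k}`. Then the degree of `m⃗` in `Θ`
is at most `2`, and moreover
`T(m⃗) = Θ² Σ_{|I|≥5} η_I ⊗ v_{I,2} + Θ Σ_{|I|≥3} η_I ⊗ v_{I,1} + Σ_{|I|≥1} η_I ⊗ v_{I,0}`.

Everything is made explicit: `Ind(F) ≅ ℂ[Θ] ⊗ Λ(6) ⊗ F` is encoded as finitely
supported functions on `ℕ × Finset (Fin 6)` with values in `F`; `T` is the
Hodge-duality isomorphism; and "singular" is expressed by the conditions S1–S3 on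
`T(m⃗)`, via the explicit dual λ-action of Proposition `actiondualck6`.
-/

open Finset in
/-- Koszul inversion count. -/
def invCount (s u : Finset (Fin 6)) : ℕ :=
  ((s ×ˢ u).filter fun p => p.2 < p.1).card

/-- the Grassmann algebra `Λ(6)` (equivalently, the span of the `η`-monomials),
with basis indexed by `Finset (Fin 6)`. -/
abbrev E6 := Finset (Fin 6) →₀ ℂ

/-- the signed (Grassmann) product. -/
noncomputable def emul (x y : E6) : E6 :=
  x.sum fun s a => y.sum fun u b =>
    if Disjoint s u then Finsupp.single (s ∪ u) (a * b * (-1 : ℂ) ^ invCount s u) else 0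

/-- the basis monomial `ξ_s` (equivalently `η_s`). -/
noncomputable def xiF (s : Finset (Fin 6)) : E6 := Finsupp.single s 1

/-- the odd derivation `∂_i`. -/
noncomputable def dE (i : Fin 6) (x : E6) : E6 :=
  x.sum fun s a =>
    if i ∈ s then
      Finsupp.single (s.erase i) (a * (-1 : ℂ) ^ (s.filter (· < i)).card)
    else 0

variable {F : Type*} [AddCommGroup F] [Module ℂ F]

/-- `Ind(F) ≅ ℂ[Θ] ⊗ Λ(6) ⊗ F`: the vector `Σ Θᵏ η_I ⊗ v_{I,k}` is encoded by
`(k, I) ↦ v_{I,k}`. -/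
abbrev IndF (F : Type*) [AddCommGroup F] [Module ℂ F] := (ℕ × Finset (Fin 6)) →₀ F

/-- `e ⊗ v` placed at `Θ`-degree `k`, for `e ∈ Λ(6)`. -/
noncomputable def emb (e : E6) (k : ℕ) (v : F) : IndF F :=
  e.sum fun s c => Finsupp.single (k, s) (c • v)

/-- multiplication by `Θᵐ`. -/
noncomputable def shiftTheta (m : ℕ) (x : IndF F) : IndF F :=
  Finsupp.mapDomain (fun q => (q.1 + m, q.2)) x

/-- the sign of Proposition `actiondualck6`: `(-1)^{|L|(|L|+1)/2 + |L||I|}`. -/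
noncomputable def sgnLI (L I : Finset (Fin 6)) : ℂ :=
  (-1 : ℂ) ^ (L.card * (L.card + 1) / 2 + L.card * I.card)

/-- coefficient of `λ⁰` in `T ∘ (ξ_L)_λ ∘ T⁻¹` applied to `η_I ⊗ v` (Proposition
`actiondualck6`):
`sgn • [ (|L|-2) Θ (ξ_L ⋆ η_I) ⊗ v - (-1)^{|L|} Σᵢ (∂ᵢξ_L ⋆ ∂ᵢη_I) ⊗ v
  - Σ_{r<s} (∂_{rs}ξ_L ⋆ η_I) ⊗ ξ_{sr}.v ]`. -/
noncomputable def dualCoef0 (xact : Fin 6 → Fin 6 → Module.End ℂ F)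
    (L I : Finset (Fin 6)) (v : F) : IndF F :=
  sgnLI L I •
    ( ((L.card : ℂ) - 2) • emb (emul (xiF L) (xiF I)) 1 v
      - ((-1 : ℂ) ^ L.card) •
          ∑ i : Fin 6, emb (emul (dE i (xiF L)) (dE i (xiF I))) 0 v
      - ∑ r : Fin 6, ∑ s : Fin 6,
          if r < s then emb (emul (dE r (dE s (xiF L))) (xiF I)) 0 (xact s r v) else 0 )

/-- coefficient of `λ¹`:
`sgn • [ (ξ_L ⋆ η_I) ⊗ t.v - (-1)^{|L|} Σᵢ ∂ᵢ(ξ_{Li} ⋆ η_I) ⊗ v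
  + (-1)^{|L|} Σ_{i≠j} (∂ᵢξ_{Lj} ⋆ η_I) ⊗ ξ_{ji}.v ]`. -/
noncomputable def dualCoef1 (tact : Module.End ℂ F)
    (xact : Fin 6 → Fin 6 → Module.End ℂ F)
    (L I : Finset (Fin 6)) (v : F) : IndF F :=
  sgnLI L I •
    ( emb (emul (xiF L) (xiF I)) 0 (tact v)
      - ((-1 : ℂ) ^ L.card) •
          ∑ i : Fin 6, emb (dE i (emul (emul (xiF L) (xiF {i})) (xiF I))) 0 v
      + ((-1 : ℂ) ^ L.card) •
          ∑ i : Fin 6, ∑ j : Fin 6,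
            if i ≠ j then emb (emul (dE i (emul (xiF L) (xiF {j}))) (xiF I)) 0 (xact j i v)
            else 0 )

/-- coefficient of `λ²`: `sgn • [ - Σ_{i<j} (ξ_{Lij} ⋆ η_I) ⊗ ξ_{ji}.v ]`. -/
noncomputable def dualCoef2 (xact : Fin 6 → Fin 6 → Module.End ℂ F)
    (L I : Finset (Fin 6)) (v : F) : IndF F :=
  sgnLI L I •
    ( - ∑ i : Fin 6, ∑ j : Fin 6,
        if i < j then
          emb (emul (emul (emul (xiF L) (xiF {i})) (xiF {j})) (xiF I)) 0 (xact j i v)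
        else 0 )

/-- the three λ-coefficients above, bundled. -/
noncomputable def dualCoef (tact : Module.End ℂ F)
    (xact : Fin 6 → Fin 6 → Module.End ℂ F)
    (d : ℕ) (L I : Finset (Fin 6)) (v : F) : IndF F :=
  if d = 0 then dualCoef0 xact L I v
  else if d = 1 then dualCoef1 tact xact L I v
  else if d = 2 then dualCoef2 xact L I v
  else 0

/-- the coefficient of `λᵖ` in `T ∘ (ξ_L)_λ ∘ T⁻¹` applied to
`w = Σ Θᵏ η_I ⊗ v_{I,k}`, using Proposition `actiondualck6` together with
Lemma `lambda+thetack6`: `(ξ_L)_λ (Θᵏ ξ_I ⊗ v) = (Θ+λ)ᵏ ((ξ_L)_λ (ξ_I ⊗ v))`. -/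
noncomputable def dualAct (tact : Module.End ℂ F)
    (xact : Fin 6 → Fin 6 → Module.End ℂ F)
    (L : Finset (Fin 6)) (w : IndF F) (p : ℕ) : IndF F :=
  w.sum fun kI v =>
    ∑ d ∈ Finset.range 3,
      if d ≤ p ∧ p - d ≤ kI.1 then
        (kI.1.choose (p - d) : ℂ) •
          shiftTheta (kI.1 - (p - d)) (dualCoef tact xact d L kI.2 v)
      else 0

/-- the coefficient of `λᵖ` in
`T((ξ_L)_λ m) - i (-1)^{|L|(|L|+1)/2} λ^{3-|L|} T((ξ_L^*)_λ m)` (for `|L| ≤ 3`),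
where `w = T(m)` and `ξ_L^* = (-1)^{invCount L Lᶜ} ξ_{Lᶜ}` is the modified Hodge dual. -/
noncomputable def singCond (tact : Module.End ℂ F)
    (xact : Fin 6 → Fin 6 → Module.End ℂ F)
    (L : Finset (Fin 6)) (w : IndF F) (p : ℕ) : IndF F :=
  dualAct tact xact L w p
    - (Complex.I * (-1 : ℂ) ^ (L.card * (L.card + 1) / 2) *
        (-1 : ℂ) ^ invCount L Lᶜ) •
      (if 3 - L.card ≤ p then dualAct tact xact Lᶜ w (p - (3 - L.card)) else 0)

/-- `m` (with `w = T(m)`) is a singular vector: conditions S1, S2, S3. -/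
def IsSingular (tact : Module.End ℂ F)
    (xact : Fin 6 → Fin 6 → Module.End ℂ F) (w : IndF F) : Prop :=
  ∀ L : Finset (Fin 6), L.card ≤ 3 →
    -- S1 (`0 ≤ |L| ≤ 3`): the second `λ`-derivative vanishes:
    (∀ p : ℕ, 2 ≤ p → singCond tact xact L w p = 0) ∧
    -- S2 (`1 ≤ |L| ≤ 3`): the first `λ`-derivative at `λ = 0` vanishes:
    (1 ≤ L.card → singCond tact xact L w 1 = 0) ∧
    -- S3 (`|L| = 3`): the value at `λ = 0` vanishes:
    (L.card = 3 → singCond tact xact L w 0 = 0)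

/-- the Hodge-duality isomorphism `T : Θᵏ η_I ⊗ v ↦ Θᵏ η̄_I ⊗ v`,
`η̄_I = (-1)^{invCount Iᶜ I} η_{Iᶜ}`. -/
noncomputable def Tmap (m : IndF F) : IndF F :=
  m.sum fun q v => Finsupp.single (q.1, q.2ᶜ) (((-1 : ℂ) ^ invCount q.2ᶜ q.2) • v)

/-- the hypotheses making `F` a finite-dimensional irreducible `g_{≥0} = g₀ ⊕ g_{>0}`-module
with `g_{>0}` acting trivially: `tact` is the action of the grading element `t` and
`xact i j` that of `ξ_{ij} ∈ so(6)`. -/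
structure IsG0Module (F : Type*) [AddCommGroup F] [Module ℂ F]
    (tact : Module.End ℂ F) (xact : Fin 6 → Fin 6 → Module.End ℂ F) : Prop where
  finiteDim : FiniteDimensional ℂ F
  skew : ∀ i j : Fin 6, xact i j = -xact j i
  t_central : ∀ i j : Fin 6, tact * xact i j = xact i j * tact
  so6_rel : ∀ a b c d : Fin 6,
    xact a b * xact c d - xact c d * xact a b =
      (if a = c then xact b d else 0) - (if a = d then xact b c else 0)
        - (if b = c then xact a d else 0) + (if b = d then xact a c else 0)
  irreducible : ∀ W : Submodule ℂ F,
    (∀ v ∈ W, tact v ∈ W) → (∀ i j : Fin 6, ∀ v ∈ W, xact i j v ∈ W) → W = ⊥ ∨ W = ⊤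
  nontriv : Nontrivial F

lemma xiF_support {s J : Finset (Fin 6)} (h : xiF s J ≠ 0) : J = s := by
  by_contra hne
  exact h (Finsupp.single_eq_of_ne hne)

lemma emul_support {x y : E6} {J : Finset (Fin 6)} (h : emul x y J ≠ 0) :
    ∃ s u, x s ≠ 0 ∧ y u ≠ 0 ∧ Disjoint s u ∧ J = s ∪ u := by
  contrapose! h
  rw [emul, Finsupp.sum, Finsupp.finsetSum_apply]
  refine Finset.sum_eq_zero fun s hs => ?_
  rw [Finsupp.sum, Finsupp.finsetSum_apply]
  refine Finset.sum_eq_zero fun u hu => ?_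
  split_ifs with hd
  · exact Finsupp.single_eq_of_ne
      (h s u (Finsupp.mem_support_iff.1 hs) (Finsupp.mem_support_iff.1 hu) hd)
  · rfl

lemma dE_support {i : Fin 6} {x : E6} {J : Finset (Fin 6)} (h : dE i x J ≠ 0) :
    ∃ s, x s ≠ 0 ∧ i ∈ s ∧ J = s.erase i := by
  contrapose! h
  rw [dE, Finsupp.sum, Finsupp.finsetSum_apply]
  refine Finset.sum_eq_zero fun s hs => ?_
  split_ifs with hi
  · exact Finsupp.single_eq_of_ne (h s (Finsupp.mem_support_iff.1 hs) hi)
  · rfl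

lemma dE_xiF_support {i : Fin 6} {L J : Finset (Fin 6)} (h : dE i (xiF L) J ≠ 0) :
    i ∈ L ∧ J = L.erase i := by
  obtain ⟨s, hs, hi, rfl⟩ := dE_support h
  obtain rfl := xiF_support hs
  exact ⟨hi, rfl⟩

lemma emul_xiF_support {L I J : Finset (Fin 6)} (h : emul (xiF L) (xiF I) J ≠ 0) :
    Disjoint L I ∧ J = L ∪ I := by
  obtain ⟨s, u, hs, hu, hd, rfl⟩ := emul_support h
  obtain rfl := xiF_support hs
  obtain rfl := xiF_support hu
  exact ⟨hd, rfl⟩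

lemma emul_dE_dE_support {i : Fin 6} {L I J : Finset (Fin 6)}
    (h : emul (dE i (xiF L)) (dE i (xiF I)) J ≠ 0) :
    i ∈ L ∧ i ∈ I ∧ Disjoint (L.erase i) (I.erase i) ∧ J = L.erase i ∪ I.erase i := by
  obtain ⟨s, u, hs, hu, hd, rfl⟩ := emul_support h
  obtain ⟨h1, rfl⟩ := dE_xiF_support hs
  obtain ⟨h2, rfl⟩ := dE_xiF_support hu
  exact ⟨h1, h2, hd, rfl⟩

lemma emul_dE_dE_xiF_support {r s : Fin 6} {L I J : Finset (Fin 6)}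
    (h : emul (dE r (dE s (xiF L))) (xiF I) J ≠ 0) :
    s ∈ L ∧ r ∈ L.erase s ∧ Disjoint ((L.erase s).erase r) I ∧
      J = (L.erase s).erase r ∪ I := by
  obtain ⟨x, u, hx, hu, hd, rfl⟩ := emul_support h
  obtain ⟨y, hy, hr, rfl⟩ := dE_support hx
  obtain ⟨hs, rfl⟩ := dE_xiF_support hy
  obtain rfl := xiF_support hu
  exact ⟨hs, hr, hd, rfl⟩

lemma emul_single_single {s u : Finset (Fin 6)} (h : Disjoint s u) (a b : ℂ) :
    emul (Finsupp.single s a) (Finsupp.single u b) =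
      Finsupp.single (s ∪ u) (a * b * (-1 : ℂ) ^ invCount s u) := by
  simp [emul, Finsupp.sum_single_index, h]

lemma dE_single {i : Fin 6} {s : Finset (Fin 6)} (h : i ∈ s) (a : ℂ) :
    dE i (Finsupp.single s a) =
      Finsupp.single (s.erase i) (a * (-1 : ℂ) ^ (s.filter (· < i)).card) := by
  simp [dE, Finsupp.sum_single_index, h]

lemma emb_apply (e : E6) (k : ℕ) (v : F) (n : ℕ) (J : Finset (Fin 6)) :
    emb e k v (n, J) = if n = k then e J • v else 0 := by
  rw [emb, Finsupp.sum, Finsupp.finsetSum_apply]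
  split_ifs with h
  · subst h
    rw [Finset.sum_eq_single J]
    · simp
    · intro s _ hs
      exact Finsupp.single_eq_of_ne (by simpa using hs.symm)
    · intro hJ
      simp [Finsupp.notMem_support_iff.1 hJ]
  · exact Finset.sum_eq_zero fun s _ => Finsupp.single_eq_of_ne (by simp [h])

lemma emb_apply_eq_zero {e : E6} {k : ℕ} {v : F} {n : ℕ} {J : Finset (Fin 6)}
    (h : n = k → e J ≠ 0 → v = 0) : emb e k v (n, J) = 0 := by
  rw [emb_apply]
  split_ifs with hn
  · by_cases he : e J = 0
    · simp [he]
    · simp [h hn he]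
  · rfl

lemma shiftTheta_apply (m : ℕ) (x : IndF F) (q : ℕ) (J : Finset (Fin 6)) :
    shiftTheta m x (q, J) = if m ≤ q then x (q - m, J) else 0 := by
  have hinj : Function.Injective (fun q : ℕ × Finset (Fin 6) => (q.1 + m, q.2)) := by
    rintro ⟨a, b⟩ ⟨c, d⟩ h
    simpa using h
  split_ifs with h
  · have := Finsupp.mapDomain_apply hinj x (q - m, J)
    simpa [shiftTheta, Nat.sub_add_cancel h] using this
  · refine Finsupp.mapDomain_of_notMem_range _ _ ?_
    rintro ⟨⟨a, b⟩, hab⟩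
    simp only [Prod.mk.injEq] at hab
    omega

lemma sgnLI_ne_zero (L I : Finset (Fin 6)) : sgnLI L I ≠ 0 :=
  pow_ne_zero _ (by norm_num)

section Action

variable (tact : Module.End ℂ F) (xact : Fin 6 → Fin 6 → Module.End ℂ F)

lemma dualCoef0_apply (L I : Finset (Fin 6)) (v : F) (n : ℕ) (J : Finset (Fin 6)) :
    dualCoef0 xact L I v (n, J) = sgnLI L I •
      (((L.card : ℂ) - 2) • emb (emul (xiF L) (xiF I)) 1 v (n, J)
      - ((-1 : ℂ) ^ L.card) •
          ∑ i : Fin 6, emb (emul (dE i (xiF L)) (dE i (xiF I))) 0 v (n, J)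
      - ∑ r : Fin 6, ∑ s : Fin 6,
          if r < s then emb (emul (dE r (dE s (xiF L))) (xiF I)) 0 (xact s r v) (n, J)
          else 0) := by
  simp only [dualCoef0, Finsupp.smul_apply, Finsupp.sub_apply, Finsupp.finsetSum_apply,
    apply_ite (fun f : IndF F => f (n, J)), Finsupp.zero_apply]

lemma dualCoef1_apply (L I : Finset (Fin 6)) (v : F) (n : ℕ) (J : Finset (Fin 6)) :
    dualCoef1 tact xact L I v (n, J) = sgnLI L I •
      (emb (emul (xiF L) (xiF I)) 0 (tact v) (n, J)
      - ((-1 : ℂ) ^ L.card) •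
          ∑ i : Fin 6, emb (dE i (emul (emul (xiF L) (xiF {i})) (xiF I))) 0 v (n, J)
      + ((-1 : ℂ) ^ L.card) •
          ∑ i : Fin 6, ∑ j : Fin 6,
            if i ≠ j then
              emb (emul (dE i (emul (xiF L) (xiF {j}))) (xiF I)) 0 (xact j i v) (n, J)
            else 0) := by
  simp only [dualCoef1, Finsupp.smul_apply, Finsupp.sub_apply, Finsupp.add_apply,
    Finsupp.finsetSum_apply, apply_ite (fun f : IndF F => f (n, J)), Finsupp.zero_apply]

lemma dualAct_zero_apply (L : Finset (Fin 6)) (w : IndF F) (q : ℕ) (J : Finset (Fin 6)) :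
    dualAct tact xact L w 0 (q, J) = ∑ kI ∈ w.support,
      if kI.1 ≤ q then dualCoef0 xact L kI.2 (w kI) (q - kI.1, J) else 0 := by
  rw [dualAct, Finsupp.sum, Finsupp.finsetSum_apply]
  refine Finset.sum_congr rfl fun kI _ => ?_
  simp [dualCoef, shiftTheta_apply]

lemma dualAct_one_apply (L : Finset (Fin 6)) (w : IndF F) (q : ℕ) (J : Finset (Fin 6)) :
    dualAct tact xact L w 1 (q, J) = ∑ kI ∈ w.support,
      ((if 1 ≤ kI.1 ∧ kI.1 - 1 ≤ q then
          (kI.1 : ℂ) • dualCoef0 xact L kI.2 (w kI) (q - (kI.1 - 1), J) else 0)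
        + if kI.1 ≤ q then dualCoef1 tact xact L kI.2 (w kI) (q - kI.1, J) else 0) := by
  rw [dualAct, Finsupp.sum, Finsupp.finsetSum_apply]
  refine Finset.sum_congr rfl fun kI _ => ?_
  by_cases h : 1 ≤ kI.1 <;>
    simp [Finset.sum_range_succ, dualCoef, shiftTheta_apply, h]

lemma dualCoef0_singleton_apply {a : Fin 6} {J : Finset (Fin 6)} (ha : a ∉ J)
    (I : Finset (Fin 6)) (v : F) (n : ℕ) (h : ¬(n = 0 ∧ I = insert a J)) :
    dualCoef0 xact {a} I v (n, J) = 0 := by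
  rw [dualCoef0_apply, emb_apply_eq_zero, Finset.sum_eq_zero, Finset.sum_eq_zero]
  · simp
  · refine fun r _ => Finset.sum_eq_zero fun s _ => ?_
    split_ifs with hrs
    · refine emb_apply_eq_zero fun _ he => ?_
      obtain ⟨hs, hr, -⟩ := emul_dE_dE_xiF_support he
      simp_all
    · rfl
  · refine fun i _ => emb_apply_eq_zero fun hn he => ?_
    obtain ⟨hi, hiI, -, rfl⟩ := emul_dE_dE_support he
    obtain rfl := Finset.mem_singleton.1 hi
    exact absurd ⟨hn, by simp [Finset.insert_erase hiI]⟩ h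
  · intro _ he
    obtain ⟨-, rfl⟩ := emul_xiF_support he
    simp at ha

lemma dualCoef0_singleton_insert_eq_zero_iff {a : Fin 6} {J : Finset (Fin 6)} (ha : a ∉ J)
    (v : F) : dualCoef0 xact {a} (insert a J) v (0, J) = 0 ↔ v = 0 := by
  refine ⟨fun h => ?_, fun h => by rw [h, dualCoef0_apply]; simp [emb_apply]⟩
  rw [dualCoef0_apply, emb_apply_eq_zero (by simp), Finset.sum_eq_single a,
    Finset.sum_eq_zero] at h
  · rw [xiF, xiF, dE_single (by simp), dE_single (by simp),
      emul_single_single (by simp), emb_apply] at h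
    simpa [sgnLI_ne_zero, ha] using h
  · refine fun r _ => Finset.sum_eq_zero fun s _ => ?_
    split_ifs with hrs
    · refine emb_apply_eq_zero fun _ he => ?_
      obtain ⟨hs, hr, -⟩ := emul_dE_dE_xiF_support he
      simp_all
    · rfl
  · refine fun i _ hi => emb_apply_eq_zero fun _ he => ?_
    exact absurd (Finset.mem_singleton.1 (emul_dE_dE_support he).1) hi
  · simp

lemma dualCoef1_singleton_apply {a : Fin 6} {J : Finset (Fin 6)} (ha : a ∉ J)
    (I : Finset (Fin 6)) (v : F) (n : ℕ)
    (h : ∀ j ∈ J, n = 0 → I = J.erase j → xact j a v = 0) :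
    dualCoef1 tact xact {a} I v (n, J) = 0 := by
  rw [dualCoef1_apply, emb_apply_eq_zero, Finset.sum_eq_zero, Finset.sum_eq_zero]
  · simp
  · refine fun i _ => Finset.sum_eq_zero fun j _ => ?_
    split_ifs with hij
    · refine emb_apply_eq_zero fun hn he => ?_
      obtain ⟨x, u, hx, hu, hd, rfl⟩ := emul_support he
      obtain ⟨y, hy, hi, rfl⟩ := dE_support hx
      obtain ⟨hd', rfl⟩ := emul_xiF_support hy
      obtain rfl := xiF_support hu
      have hia : i = a := by
        by_contra hne
        exact ha (by simp [Ne.symm hne])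
      subst hia
      have hje : (({i} : Finset (Fin 6)) ∪ {j}).erase i = {j} := by
        ext x
        simp only [Finset.mem_erase, Finset.mem_union, Finset.mem_singleton]
        grind
      rw [hje] at hd h
      refine h j (by simp) hn ?_
      rw [← Finset.insert_eq, Finset.erase_insert (by simpa using hd)]
    · rfl
  · refine fun i _ => emb_apply_eq_zero fun _ he => ?_
    obtain ⟨y, hy, hi, rfl⟩ := dE_support he
    obtain ⟨x, u, hx, hu, hd, rfl⟩ := emul_support hy
    obtain ⟨hd', rfl⟩ := emul_xiF_support hx
    have hia : a ≠ i := by simpa using hd'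
    exact absurd (by simp [hia]) ha
  · intro _ he
    obtain ⟨-, rfl⟩ := emul_xiF_support he
    simp at ha

variable {tact xact}

lemma IsSingular.dualAct_singleton {w : IndF F} (hw : IsSingular tact xact w) (a : Fin 6) :
    dualAct tact xact {a} w 1 = 0 := by
  simpa [singCond] using (hw {a} (by simp)).2.1 (by simp)

lemma IsSingular.apply_insert {w : IndF F} (hw : IsSingular tact xact w) {a : Fin 6}
    {J : Finset (Fin 6)} (ha : a ∉ J) (q : ℕ)
    (h : ∀ j ∈ J, xact j a (w (q, J.erase j)) = 0) : w (q + 1, insert a J) = 0 := by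
  have h0 := DFunLike.congr_fun (hw.dualAct_singleton a) (q, J)
  have hcoef1 : ∀ kI : ℕ × Finset (Fin 6),
      (if kI.1 ≤ q then dualCoef1 tact xact {a} kI.2 (w kI) (q - kI.1, J) else 0) = 0 := by
    rintro ⟨k, I⟩
    split_ifs with hk
    · refine dualCoef1_singleton_apply tact xact ha _ _ _ fun j hj hn hI => ?_
      have hk' : k = q := by dsimp only at hk hn; omega
      dsimp only at hI
      rw [hk', hI]
      exact h j hj
    · rfl
  rw [dualAct_one_apply, Finset.sum_eq_single (q + 1, insert a J)] at h0
  · rw [hcoef1, add_zero] at h0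
    have hq : ((q + 1 : ℕ) : ℂ) ≠ 0 := Nat.cast_ne_zero.2 q.succ_ne_zero
    rw [if_pos (by simp)] at h0
    simpa [hq, dualCoef0_singleton_insert_eq_zero_iff xact ha,
      -Nat.cast_add] using h0
  · rintro ⟨k, I⟩ - hne
    rw [hcoef1, add_zero]
    split_ifs with hk
    · rw [dualCoef0_singleton_apply xact ha, smul_zero]
      rintro ⟨hn, rfl⟩
      dsimp only at hk hn
      exact hne (by rw [show k = q + 1 by omega])
    · rfl
  · intro hs
    rw [hcoef1, Finsupp.notMem_support_iff.1 hs, dualCoef0_apply]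
    simp [emb_apply]

variable (xact) in
lemma dualCoef0_apply_of_disjoint {L J : Finset (Fin 6)} (hL : L.card = 3)
    (hJ : Disjoint L J) (I : Finset (Fin 6)) (v : F) (n : ℕ) :
    dualCoef0 xact L I v (n, J) = 0 := by
  have key : ∀ S I : Finset (Fin 6), S ⊆ L → 1 ≤ S.card → J ≠ S ∪ I := by
    rintro S I hS hc rfl
    obtain ⟨x, hx⟩ := Finset.card_pos.1 hc
    exact Finset.disjoint_left.1 hJ (hS hx) (Finset.mem_union_left _ hx)
  rw [dualCoef0_apply, emb_apply_eq_zero, Finset.sum_eq_zero, Finset.sum_eq_zero]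
  · simp
  · refine fun r _ => Finset.sum_eq_zero fun s _ => ?_
    split_ifs with hrs
    · refine emb_apply_eq_zero fun _ he => ?_
      obtain ⟨hs, hr, -, hJ'⟩ := emul_dE_dE_xiF_support he
      refine absurd hJ' (key _ _ ((Finset.erase_subset _ _).trans (Finset.erase_subset _ _)) ?_)
      rw [Finset.card_erase_of_mem hr, Finset.card_erase_of_mem hs, hL]
    · rfl
  · refine fun i _ => emb_apply_eq_zero fun _ he => ?_
    obtain ⟨hi, -, -, hJ'⟩ := emul_dE_dE_support he
    refine absurd hJ' (key _ _ (Finset.erase_subset _ _) ?_)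
    rw [Finset.card_erase_of_mem hi, hL]
    norm_num
  · intro _ he
    exact absurd (emul_xiF_support he).2 (key _ _ subset_rfl (by omega))

lemma IsSingular.dualAct_apply_of_subset {w : IndF F} (hw : IsSingular tact xact w)
    {L J : Finset (Fin 6)} (hL : L.card = 3) (hJ : J ⊆ L) (q : ℕ) :
    dualAct tact xact L w 0 (q, J) = 0 := by
  have h := DFunLike.congr_fun ((hw L hL.le).2.2 hL) (q, J)
  have hc : dualAct tact xact Lᶜ w 0 (q, J) = 0 := by
    rw [dualAct_zero_apply]
    refine Finset.sum_eq_zero fun kI _ => ?_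
    rw [dualCoef0_apply_of_disjoint xact (by simp [Finset.card_compl, hL])
      (disjoint_compl_left.mono_right hJ), ite_self]
  simpa [singCond, hL, hc] using h

variable (xact) in
lemma dualCoef0_apply_singleton {L : Finset (Fin 6)} (hL : L.card = 3) (a : Fin 6)
    (I : Finset (Fin 6)) (v : F) (n : ℕ) (h : ¬(n = 0 ∧ I = ∅)) :
    dualCoef0 xact L I v (n, {a}) = 0 := by
  rw [dualCoef0_apply, emb_apply_eq_zero, Finset.sum_eq_zero, Finset.sum_eq_zero]
  · simp
  · refine fun r _ => Finset.sum_eq_zero fun s _ => ?_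
    split_ifs with hrs
    · refine emb_apply_eq_zero fun hn he => ?_
      obtain ⟨hs, hr, hd, hJ⟩ := emul_dE_dE_xiF_support he
      have hc := congrArg Finset.card hJ
      rw [Finset.card_union_of_disjoint hd, Finset.card_erase_of_mem hr,
        Finset.card_erase_of_mem hs, hL, Finset.card_singleton] at hc
      exact absurd ⟨hn, Finset.card_eq_zero.1 (by omega)⟩ h
    · rfl
  · refine fun i _ => emb_apply_eq_zero fun _ he => ?_
    obtain ⟨hi, -, hd, hJ⟩ := emul_dE_dE_support he
    have hc := congrArg Finset.card hJ
    rw [Finset.card_union_of_disjoint hd, Finset.card_erase_of_mem hi, hL,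
      Finset.card_singleton] at hc
    omega
  · intro _ he
    obtain ⟨hd, hJ⟩ := emul_xiF_support he
    have hc := congrArg Finset.card hJ
    rw [Finset.card_union_of_disjoint hd, hL, Finset.card_singleton] at hc
    omega

variable (xact) in
lemma dualCoef0_triple_empty_eq_zero_iff {a r s : Fin 6} (har : a ≠ r) (has : a ≠ s)
    (hrs : r < s) (v : F) :
    dualCoef0 xact {a, r, s} ∅ v (0, {a}) = 0 ↔ xact s r v = 0 := by
  have hs : s ∈ ({a, r, s} : Finset (Fin 6)) := by simp
  have hr : r ∈ ({a, r, s} : Finset (Fin 6)).erase s := by simp [hrs.ne]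
  have ha : (({a, r, s} : Finset (Fin 6)).erase s).erase r = {a} := by
    ext x
    simp only [Finset.mem_erase, Finset.mem_insert, Finset.mem_singleton]
    grind
  have hne : ∀ r' s' : Fin 6, ¬(r' = r ∧ s' = s) →
      (if r' < s' then
        emb (emul (dE r' (dE s' (xiF {a, r, s}))) (xiF ∅)) 0 (xact s' r' v) (0, {a})
      else 0) = 0 := by
    intro r' s' h
    split_ifs with hlt
    · refine emb_apply_eq_zero fun _ he => ?_
      obtain ⟨hs', hr', -, hJ⟩ := emul_dE_dE_xiF_support he
      have hmem : a ∈ (({a, r, s} : Finset (Fin 6)).erase s').erase r' ∪ ∅ := by simp [← hJ]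
      simp only [Finset.mem_erase, Finset.mem_insert, Finset.mem_singleton,
        Finset.union_empty] at hs' hr' hmem
      grind
    · rfl
  rw [dualCoef0_apply, emb_apply_eq_zero (by simp), Finset.sum_eq_zero, Finset.sum_eq_single r,
    Finset.sum_eq_single s, if_pos hrs]
  · rw [xiF, xiF, dE_single hs, dE_single hr, emul_single_single (by simp), emb_apply, ha]
    simp [sgnLI_ne_zero]
  · exact fun s' _ h => hne r s' fun h' => h h'.2
  · simp
  · exact fun r' _ h => Finset.sum_eq_zero fun s' _ => hne r' s' fun h' => h h'.1
  · simp
  · refine fun i _ => emb_apply_eq_zero fun _ he => ?_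
    exact absurd (emul_dE_dE_support he).2.1 (Finset.notMem_empty i)

variable (xact) in
lemma dualCoef0_apply_self {L : Finset (Fin 6)} (I : Finset (Fin 6)) (v : F) (n : ℕ)
    (h : ¬(n = 1 ∧ I = ∅)) (hv : ∀ r s, r < s → n = 0 → I = {r, s} → v = 0) :
    dualCoef0 xact L I v (n, L) = 0 := by
  rw [dualCoef0_apply, emb_apply_eq_zero, Finset.sum_eq_zero, Finset.sum_eq_zero]
  · simp
  · refine fun r _ => Finset.sum_eq_zero fun s _ => ?_
    split_ifs with hrs
    · refine emb_apply_eq_zero fun hn he => ?_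
      obtain ⟨hs, hr, hd, hJ⟩ := emul_dE_dE_xiF_support he
      have hI : I = {r, s} := by
        have hIL := Finset.union_sdiff_cancel_left hd
        rw [← hJ] at hIL
        rw [← hIL]
        ext x
        simp only [Finset.mem_sdiff, Finset.mem_erase, Finset.mem_insert,
          Finset.mem_singleton] at hs hr ⊢
        grind
      rw [hv r s hrs hn hI, map_zero]
    · rfl
  · refine fun i _ => emb_apply_eq_zero fun _ he => ?_
    obtain ⟨hi, -, -, hJ⟩ := emul_dE_dE_support he
    rw [hJ] at hi
    simp at hi
  · intro hn he
    obtain ⟨hd, hJ⟩ := emul_xiF_support he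
    have hIL : I ⊆ L := hJ ▸ Finset.subset_union_right
    exact absurd ⟨hn, by simpa using hd.mono_left hIL⟩ h

variable (xact) in
lemma dualCoef0_self_empty_eq_zero_iff {L : Finset (Fin 6)} (hL : L.card = 3) (v : F) :
    dualCoef0 xact L ∅ v (1, L) = 0 ↔ v = 0 := by
  rw [dualCoef0_apply, Finset.sum_eq_zero, Finset.sum_eq_zero]
  · rw [xiF, xiF, emul_single_single (by simp), emb_apply]
    norm_num [sgnLI_ne_zero, hL]
  · refine fun r _ => Finset.sum_eq_zero fun s _ => ?_
    rw [emb_apply_eq_zero (by simp), ite_self]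
  · exact fun i _ => emb_apply_eq_zero (by simp)

lemma IsSingular.xact_apply_empty {w : IndF F} (hw : IsSingular tact xact w) (k : ℕ)
    {r s : Fin 6} (hrs : r < s) : xact s r (w (k, ∅)) = 0 := by
  obtain ⟨a, har, has⟩ : ∃ a : Fin 6, a ≠ r ∧ a ≠ s := by
    clear hrs
    revert r s
    decide
  have hL : ({a, r, s} : Finset (Fin 6)).card = 3 :=
    Finset.card_eq_three.2 ⟨a, r, s, har, has, hrs.ne, rfl⟩
  have h := hw.dualAct_apply_of_subset hL (J := {a}) (by simp) k
  rw [dualAct_zero_apply, Finset.sum_eq_single (k, ∅)] at h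
  · simpa [dualCoef0_triple_empty_eq_zero_iff xact har has hrs] using h
  · rintro ⟨k', I⟩ - hne
    split_ifs with hk
    · refine dualCoef0_apply_singleton xact hL a _ _ _ ?_
      rintro ⟨hn, rfl⟩
      dsimp only at hk hn
      exact hne (by rw [show k' = k by omega])
    · rfl
  · intro hs
    rw [Finsupp.notMem_support_iff.1 hs, dualCoef0_apply]
    simp [emb_apply]

lemma IsSingular.apply_empty {w : IndF F} (hw : IsSingular tact xact w) (k : ℕ) :
    w (k, ∅) = 0 := by
  have hpair : ∀ r s : Fin 6, r < s → w (k + 1, {r, s}) = 0 := fun r s hrs =>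
    hw.apply_insert (by simpa using hrs.ne) k fun j hj => by
      obtain rfl := Finset.mem_singleton.1 hj
      simpa using hw.xact_apply_empty k hrs
  have hL : ({0, 1, 2} : Finset (Fin 6)).card = 3 := rfl
  have h := hw.dualAct_apply_of_subset hL subset_rfl (k + 1)
  rw [dualAct_zero_apply, Finset.sum_eq_single (k, ∅)] at h
  · rw [if_pos (by simp)] at h
    simpa only [Nat.add_sub_cancel_left, dualCoef0_self_empty_eq_zero_iff xact hL] using h
  · rintro ⟨k', I⟩ - hne
    split_ifs with hk
    · refine dualCoef0_apply_self xact _ _ _ ?_ fun r s hrs hn hI => ?_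
      · rintro ⟨hn, rfl⟩
        dsimp only at hk hn
        exact hne (by rw [show k' = k by omega])
      · dsimp only at hk hn hI
        rw [show k' = k + 1 by omega, hI]
        exact hpair r s hrs
    · rfl
  · intro hs
    rw [Finsupp.notMem_support_iff.1 hs, dualCoef0_apply]
    simp [emb_apply]

lemma IsSingular.apply_of_card_le {w : IndF F} (hw : IsSingular tact xact w) (k : ℕ)
    (I : Finset (Fin 6)) (hI : I.card ≤ 2 * k) : w (k, I) = 0 := by
  induction k generalizing I with
  | zero =>
    obtain rfl : I = ∅ := Finset.card_eq_zero.1 (by omega)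
    exact hw.apply_empty 0
  | succ q ih =>
    obtain rfl | ⟨a, ha⟩ := I.eq_empty_or_nonempty
    · exact hw.apply_empty _
    · rw [← Finset.insert_erase ha]
      refine hw.apply_insert (Finset.notMem_erase a I) q fun j hj => ?_
      rw [ih, map_zero]
      rw [Finset.card_erase_of_mem hj, Finset.card_erase_of_mem ha]
      omega

end Action

theorem singular_vector_theta_degree_le_two
    {F : Type*} [AddCommGroup F] [Module ℂ F]
    (tact : Module.End ℂ F) (xact : Fin 6 → Fin 6 → Module.End ℂ F)
    (hF : IsG0Module F tact xact)
    (m : IndF F) (hm : m ≠ 0)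
    (hsing : IsSingular tact xact (Tmap m)) :
    ∀ (k : ℕ) (s : Finset (Fin 6)),
      (3 ≤ k → Tmap m (k, s) = 0) ∧
      (k = 2 → s.card < 5 → Tmap m (k, s) = 0) ∧
      (k = 1 → s.card < 3 → Tmap m (k, s) = 0) ∧
      (k = 0 → s.card < 1 → Tmap m (k, s) = 0) := by
  intro k s
  refine ⟨fun hk => ?_, fun hk hs => ?_, fun hk hs => ?_, fun hk hs => ?_⟩ <;>
    refine hsing.apply_of_card_le k s ?_
  · have := s.card_le_univ
    rw [Fintype.card_fin] at this
    omega
  all_goals omega
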